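/- arXiv:2302.13364 — 2 statements merged into one kernel-verified Lean document; each statement's English description precedes it below -/
import Mathlib

section
/- Let G = PGL₃(ℂ) act on P² × P⁹ via the actions induced from the natural GL(V)-actions on V and S³(V*), let q = (0 : −1 : 1) ∈ P², and for λ ∈ ℂ let φ(λ) = (q, π(x₁³ + x₂³ + x₃³ + λx₁x₂x₃)) ∈ P² × P⁹, where π : S³(V*)∖{0} → P⁹ is the natural projection. Then the morphism G × 𝔸¹ → X, (g, λ) ↦ g(φ(λ)), is a dominant morphism onto the variety of flexes of plane cubics X. -/
open MvPolynomial Matrix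

noncomputable def hesseCubic (l : ℂ) : MvPolynomial (Fin 3) ℂ :=
  X 0 ^ 3 + X 1 ^ 3 + X 2 ^ 3 + C l * (X 0 * X 1 * X 2)

noncomputable def cubicMonomial (m : Sym (Fin 3) 3) : MvPolynomial (Fin 3) ℂ :=
  ((m : Multiset (Fin 3)).map X).prod

noncomputable def cubicOf (a : Sym (Fin 3) 3 → ℂ) : MvPolynomial (Fin 3) ℂ :=
  ∑ m : Sym (Fin 3) 3, C (a m) * cubicMonomial m

noncomputable def coeffVec (f : MvPolynomial (Fin 3) ℂ) : Sym (Fin 3) 3 → ℂ :=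
  fun m => coeff (Multiset.toFinsupp (m : Multiset (Fin 3))) f

noncomputable def hessianDet (f : MvPolynomial (Fin 3) ℂ) : MvPolynomial (Fin 3) ℂ :=
  (Matrix.of fun i j : Fin 3 => pderiv i (pderiv j f)).det

abbrev P2 : Type := Projectivization ℂ (Fin 3 → ℂ)
abbrev P9 : Type := Projectivization ℂ (Sym (Fin 3) 3 → ℂ)

def FlexVariety : Set (P2 × P9) :=
  {z | ∃ (x : Fin 3 → ℂ) (hx : x ≠ 0) (a : Sym (Fin 3) 3 → ℂ) (ha : a ≠ 0),
    z = (Projectivization.mk ℂ x hx, Projectivization.mk ℂ a ha) ∧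
    eval x (cubicOf a) = 0 ∧ eval x (hessianDet (cubicOf a)) = 0}

/-- The thirteen homogeneous coordinates on `P² × P⁹`: three `x`-variables and
ten `a`-variables. -/
abbrev Vars : Type := Fin 3 ⊕ Sym (Fin 3) 3

/-- A polynomial in the coordinates of `P² × P⁹` is bihomogeneous of bidegree `(m, n)`
if it is homogeneous of degree `m` in the `x`-variables and of degree `n` in the
`a`-variables. -/
def IsBihomogeneous (P : MvPolynomial Vars ℂ) (m n : ℕ) : Prop :=
  P.IsWeightedHomogeneous (Sum.elim (fun _ => 1) (fun _ => 0)) m ∧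
  P.IsWeightedHomogeneous (Sum.elim (fun _ => 0) (fun _ => 1)) n

/-- A polynomial in the coordinates of `P² × P⁹` vanishes on a set `S ⊆ P² × P⁹`. -/
def VanishesOn (P : MvPolynomial Vars ℂ) (S : Set (P2 × P9)) : Prop :=
  ∀ (x : Fin 3 → ℂ) (hx : x ≠ 0) (a : Sym (Fin 3) 3 → ℂ) (ha : a ≠ 0),
    (Projectivization.mk ℂ x hx, Projectivization.mk ℂ a ha) ∈ S →
      eval (Sum.elim x a) P = 0

/-- A subset `S` of the variety of flexes `X ⊆ P² × P⁹` is (Zariski) dense in `X`: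
every bihomogeneous polynomial vanishing on `S` vanishes on `X`.  A map with image `S`
is then dominant onto `X`. -/
def IsDenseInFlexVariety (S : Set (P2 × P9)) : Prop :=
  S ⊆ FlexVariety ∧
  ∀ (P : MvPolynomial Vars ℂ) (m n : ℕ), IsBihomogeneous P m n →
    VanishesOn P S → VanishesOn P FlexVariety

/-- The point `q = (0 : -1 : 1)` of `P²` (as a vector of `ℂ³`). -/
noncomputable def qvec : Fin 3 → ℂ := ![0, -1, 1]

/-- Substitution of a linear change of variables `x ↦ Ax` into a polynomial:
`(linearSubst A f)(x) = f(Ax)`. -/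
noncomputable def linearSubst (A : Matrix (Fin 3) (Fin 3) ℂ) (f : MvPolynomial (Fin 3) ℂ) :
    MvPolynomial (Fin 3) ℂ :=
  aeval (fun i => ∑ j : Fin 3, C (A i j) * X j) f

/-- The image of the morphism `G × 𝔸¹ → P² × P⁹`, `(g, λ) ↦ g · φ(λ)`, where
`G = PGL₃(ℂ)` (represented by matrices `M ∈ GL₃(ℂ)`), `φ(λ) = (q, π(f_λ))` with
`q = (0 : -1 : 1)` and `f_λ` the Hesse cubic.  The action of `g` sends the point `q` to
`Mq` and the cubic `f` to `f ∘ g⁻¹`, i.e. `x ↦ f(M⁻¹x)`. -/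
def orbitImage : Set (P2 × P9) :=
  {z | ∃ (M : GL (Fin 3) ℂ) (l : ℂ)
      (hx : (↑M : Matrix (Fin 3) (Fin 3) ℂ) *ᵥ qvec ≠ 0)
      (ha : coeffVec (linearSubst (↑M⁻¹ : Matrix (Fin 3) (Fin 3) ℂ) (hesseCubic l)) ≠ 0),
    z = (Projectivization.mk ℂ _ hx, Projectivization.mk ℂ _ ha)}


lemma cubicMonomial_eq (m : Sym (Fin 3) 3) :
    cubicMonomial m = monomial (Multiset.toFinsupp (m : Multiset (Fin 3))) 1 := by
  unfold cubicMonomial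
  generalize (m : Multiset (Fin 3)) = s
  induction s using Multiset.induction_on with
  | empty => simp
  | cons i s ih =>
    rw [Multiset.map_cons, Multiset.prod_cons, ih, ← Multiset.singleton_add, map_add,
      Multiset.toFinsupp_singleton, X, monomial_mul, one_mul]

lemma coeffVec_cubicOf (a : Sym (Fin 3) 3 → ℂ) : coeffVec (cubicOf a) = a := by
  classical
  funext n
  unfold coeffVec cubicOf
  rw [coeff_sum, Finset.sum_eq_single n]
  · simp [cubicMonomial_eq, coeff_C_mul]
  · intro m _ hm
    rw [coeff_C_mul, cubicMonomial_eq, coeff_monomial, if_neg, mul_zero]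
    intro h
    exact hm (Sym.coe_injective (Multiset.toFinsupp.injective h))
  · simp

lemma cubicMonomial_hom (m : Sym (Fin 3) 3) : (cubicMonomial m).IsHomogeneous 3 := by
  rw [cubicMonomial_eq]
  apply isHomogeneous_monomial
  rw [Finsupp.degree_eq_sum]
  have := m.2
  simp only [Multiset.toFinsupp_apply]
  rw [Multiset.sum_count_eq_card (fun a _ => Finset.mem_univ a)]
  exact this

lemma cubicOf_hom (a : Sym (Fin 3) 3 → ℂ) : (cubicOf a).IsHomogeneous 3 := by
  unfold cubicOf
  apply IsHomogeneous.sum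
  intro m _
  exact (cubicMonomial_hom m).C_mul _

lemma cubicOf_coeffVec (f : MvPolynomial (Fin 3) ℂ) (hf : f.IsHomogeneous 3) :
    cubicOf (coeffVec f) = f := by
  ext d
  by_cases hd : d.degree = 3
  · have hc : Multiset.card (Finsupp.toMultiset d) = 3 := by
      rw [Finsupp.card_toMultiset, Finsupp.sum_fintype _ _ (by simp)]
      rw [Finsupp.degree_eq_sum] at hd
      simpa using hd
    have h := congrFun (coeffVec_cubicOf (coeffVec f)) ⟨Finsupp.toMultiset d, hc⟩
    simpa [coeffVec] using h
  · rw [hf.coeff_eq_zero hd, (cubicOf_hom _).coeff_eq_zero hd]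

lemma eval_linearSubst (A : Matrix (Fin 3) (Fin 3) ℂ) (f : MvPolynomial (Fin 3) ℂ)
    (v : Fin 3 → ℂ) : eval v (linearSubst A f) = eval (A *ᵥ v) f := by
  unfold linearSubst
  induction f using MvPolynomial.induction_on with
  | C a => simp
  | add p q hp hq => rw [map_add, map_add, map_add, hp, hq]
  | mul_X p n hp =>
    rw [map_mul, map_mul, hp, map_mul, aeval_X, eval_X]
    simp [Matrix.mulVec, dotProduct]

lemma linearSubst_mul (A B : Matrix (Fin 3) (Fin 3) ℂ) (f : MvPolynomial (Fin 3) ℂ) :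
    linearSubst A (linearSubst B f) = linearSubst (B * A) f := by
  apply MvPolynomial.funext
  intro v
  simp [eval_linearSubst, Matrix.mulVec_mulVec]

lemma linearSubst_one (f : MvPolynomial (Fin 3) ℂ) : linearSubst 1 f = f := by
  apply MvPolynomial.funext
  intro v
  simp [eval_linearSubst]

lemma linearSubst_hom (A : Matrix (Fin 3) (Fin 3) ℂ) (f : MvPolynomial (Fin 3) ℂ) (n : ℕ)
    (hf : f.IsHomogeneous n) : (linearSubst A f).IsHomogeneous n := by
  have := hf.aeval (n := 1) (fun i => ∑ j : Fin 3, C (A i j) * (X j : MvPolynomial (Fin 3) ℂ)) (by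
    intro i
    apply IsHomogeneous.sum
    intro j _
    exact (isHomogeneous_X ℂ j).C_mul _)
  simpa [linearSubst] using this

lemma linearSubst_C_mul (A : Matrix (Fin 3) (Fin 3) ℂ) (c : ℂ) (f : MvPolynomial (Fin 3) ℂ) :
    linearSubst A (C c * f) = C c * linearSubst A f := by
  simp [linearSubst]

lemma coeffVec_C_mul (c : ℂ) (f : MvPolynomial (Fin 3) ℂ) :
    coeffVec (C c * f) = c • coeffVec f := by
  funext m; simp [coeffVec]

lemma coeffVec_add (f g : MvPolynomial (Fin 3) ℂ) :
    coeffVec (f + g) = coeffVec f + coeffVec g := by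
  funext m; simp [coeffVec]

/-- The general cubic, written out. -/
noncomputable def cub (c1 c2 c3 c4 c5 c6 c7 c8 c9 c10 : ℂ) : MvPolynomial (Fin 3) ℂ :=
  C c1 * (X 0 * X 0 * X 0) + C c2 * (X 0 * X 0 * X 1) + C c3 * (X 0 * X 1 * X 1)
  + C c4 * (X 1 * X 1 * X 1) + C c5 * (X 0 * X 0 * X 2) + C c6 * (X 0 * X 1 * X 2)
  + C c7 * (X 1 * X 1 * X 2) + C c8 * (X 0 * X 2 * X 2) + C c9 * (X 1 * X 2 * X 2)
  + C c10 * (X 2 * X 2 * X 2)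

lemma mon_hom (c : ℂ) (i j k : Fin 3) :
    (C c * (X i * X j * X k) : MvPolynomial (Fin 3) ℂ).IsHomogeneous 3 :=
  (((isHomogeneous_X ℂ i).mul (isHomogeneous_X ℂ j)).mul (isHomogeneous_X ℂ k)).C_mul c

lemma cub_hom (c1 c2 c3 c4 c5 c6 c7 c8 c9 c10 : ℂ) :
    (cub c1 c2 c3 c4 c5 c6 c7 c8 c9 c10).IsHomogeneous 3 := by
  unfold cub
  repeat' apply IsHomogeneous.add
  all_goals apply mon_hom

lemma eval_cub (v : Fin 3 → ℂ) (c1 c2 c3 c4 c5 c6 c7 c8 c9 c10 : ℂ) :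
    eval v (cub c1 c2 c3 c4 c5 c6 c7 c8 c9 c10) =
    c1 * v 0 ^ 3 + c2 * (v 0 ^ 2 * v 1) + c3 * (v 0 * v 1 ^ 2) + c4 * v 1 ^ 3
    + c5 * (v 0 ^ 2 * v 2) + c6 * (v 0 * v 1 * v 2) + c7 * (v 1 ^ 2 * v 2)
    + c8 * (v 0 * v 2 ^ 2) + c9 * (v 1 * v 2 ^ 2) + c10 * v 2 ^ 3 := by
  simp [cub]; ring

lemma X_lin (i : Fin 3) : ∃ p0 p1 p2 : ℂ, ∀ v : Fin 3 → ℂ,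
    v i = p0 * v 0 + p1 * v 1 + p2 * v 2 := by
  fin_cases i
  · exact ⟨1, 0, 0, fun v => by simp⟩
  · exact ⟨0, 1, 0, fun v => by simp⟩
  · exact ⟨0, 0, 1, fun v => by simp⟩

lemma exists_cub (f : MvPolynomial (Fin 3) ℂ) (hf : f.IsHomogeneous 3) :
    ∃ c1 c2 c3 c4 c5 c6 c7 c8 c9 c10 : ℂ, f = cub c1 c2 c3 c4 c5 c6 c7 c8 c9 c10 := by
  rw [← cubicOf_coeffVec f hf]
  unfold cubicOf
  apply Finset.sum_induction
    (p := fun f => ∃ c1 c2 c3 c4 c5 c6 c7 c8 c9 c10 : ℂ, f = cub c1 c2 c3 c4 c5 c6 c7 c8 c9 c10)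
  · rintro f g ⟨a1, a2, a3, a4, a5, a6, a7, a8, a9, a10, rfl⟩
      ⟨c1, c2, c3, c4, c5, c6, c7, c8, c9, c10, rfl⟩
    refine ⟨a1 + c1, a2 + c2, a3 + c3, a4 + c4, a5 + c5, a6 + c6, a7 + c7, a8 + c8, a9 + c9,
      a10 + c10, ?_⟩
    simp only [cub, C_add]
    ring
  · refine ⟨0, 0, 0, 0, 0, 0, 0, 0, 0, 0, ?_⟩
    simp [cub]
  · intro m _
    generalize coeffVec f m = a
    obtain ⟨s, hs⟩ := m
    obtain ⟨i, j, k, rfl⟩ := Multiset.card_eq_three.1 hs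
    have key : cubicMonomial ⟨{i, j, k}, hs⟩ = X i * X j * X k := by
      simp [cubicMonomial, mul_assoc]
    rw [key]
    obtain ⟨p0, p1, p2, hp⟩ := X_lin i
    obtain ⟨q0, q1, q2, hq⟩ := X_lin j
    obtain ⟨r0, r1, r2, hr⟩ := X_lin k
    refine ⟨a * (p0 * q0 * r0), a * (p0 * q0 * r1 + p0 * q1 * r0 + p1 * q0 * r0),
      a * (p0 * q1 * r1 + p1 * q0 * r1 + p1 * q1 * r0), a * (p1 * q1 * r1),
      a * (p0 * q0 * r2 + p0 * q2 * r0 + p2 * q0 * r0),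
      a * (p0 * q1 * r2 + p0 * q2 * r1 + p1 * q0 * r2 + p1 * q2 * r0 + p2 * q0 * r1
        + p2 * q1 * r0),
      a * (p1 * q1 * r2 + p1 * q2 * r1 + p2 * q1 * r1),
      a * (p0 * q2 * r2 + p2 * q0 * r2 + p2 * q2 * r0),
      a * (p1 * q2 * r2 + p2 * q1 * r2 + p2 * q2 * r1), a * (p2 * q2 * r2), ?_⟩
    apply MvPolynomial.funext
    intro v
    rw [eval_cub]
    simp only [map_mul, eval_C, eval_X, hp v, hq v, hr v]
    ring

lemma pderiv_linearSubst (A : Matrix (Fin 3) (Fin 3) ℂ) (i : Fin 3)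
    (f : MvPolynomial (Fin 3) ℂ) :
    pderiv i (linearSubst A f) = ∑ k, C (A k i) * linearSubst A (pderiv k f) := by
  induction f using MvPolynomial.induction_on with
  | C a => simp [linearSubst]
  | add p q hp hq =>
    simp only [linearSubst, map_add] at *
    rw [hp, hq, ← Finset.sum_add_distrib]
    simp [mul_add]
  | mul_X p n hp =>
    simp only [linearSubst, map_mul, aeval_X, Derivation.leibniz, map_add, smul_eq_mul,
      pderiv_X] at *
    rw [hp]
    have h1 : pderiv i (∑ j : Fin 3, C (A n j) * (X j : MvPolynomial (Fin 3) ℂ)) = C (A n i) := by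
      rw [map_sum, Finset.sum_eq_single i]
      · simp
      · intro j _ hj
        simp [pderiv_X_of_ne hj]
      · simp
    have h2 : ∀ k : Fin 3, C (A k i) * (aeval (fun i => ∑ j : Fin 3, C (A i j) * X j) p *
        aeval (fun i => ∑ j : Fin 3, C (A i j) * X j) (Pi.single (M := fun _ => MvPolynomial (Fin 3) ℂ) k 1 n)) =
        if k = n then C (A n i) * aeval (fun i => ∑ j : Fin 3, C (A i j) * (X j : MvPolynomial (Fin 3) ℂ)) p else 0 := by
      intro k
      split_ifs with h
      · subst h; simp
      · rw [Pi.single_eq_of_ne (Ne.symm h)]; simp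
    rw [h1]
    simp only [mul_add, h2, Finset.sum_add_distrib, Finset.sum_ite_eq', Finset.mem_univ, if_true, Finset.mul_sum]
    rw [mul_comm]
    congr 1
    exact Finset.sum_congr rfl fun _ _ => by ring

lemma hessianDet_linearSubst (A : Matrix (Fin 3) (Fin 3) ℂ) (f : MvPolynomial (Fin 3) ℂ) :
    hessianDet (linearSubst A f) = C (A.det ^ 2) * linearSubst A (hessianDet f) := by
  have h1 : (Matrix.of fun i j : Fin 3 => pderiv i (pderiv j (linearSubst A f))) =
      (A.map C)ᵀ * ((Matrix.of fun i j : Fin 3 => pderiv i (pderiv j f)).map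
        (aeval (fun i => ∑ j : Fin 3, C (A i j) * X j) :
          MvPolynomial (Fin 3) ℂ →ₐ[ℂ] MvPolynomial (Fin 3) ℂ).toRingHom) * A.map C := by
    ext1 i j
    rw [Matrix.of_apply, pderiv_linearSubst]
    simp only [map_sum, Derivation.leibniz, pderiv_linearSubst, pderiv_C,
      Matrix.mul_apply, Matrix.transpose_apply, Matrix.map_apply, Matrix.of_apply, smul_eq_mul]
    simp only [Fin.sum_univ_three, linearSubst, AlgHom.toRingHom_eq_coe, RingHom.coe_coe]
    ring
  unfold hessianDet
  rw [h1, Matrix.det_mul, Matrix.det_mul, Matrix.det_transpose]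
  have h2 : (A.map C).det = (C A.det : MvPolynomial (Fin 3) ℂ) := (RingHom.map_det C A).symm
  rw [h2, ← RingHom.mapMatrix_apply, ← RingHom.map_det]
  simp only [linearSubst, AlgHom.toRingHom_eq_coe, RingHom.coe_coe, C_pow]
  ring


lemma eval_hess_cub (v : Fin 3 → ℂ) (c1 c2 c3 c4 c5 c6 c7 c8 c9 c10 : ℂ)
    (a00 a01 a02 a11 a12 a22 : ℂ)
    (h00 : a00 = 6 * c1 * v 0 + 2 * c2 * v 1 + 2 * c5 * v 2)
    (h01 : a01 = 2 * c2 * v 0 + 2 * c3 * v 1 + c6 * v 2)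
    (h02 : a02 = 2 * c5 * v 0 + c6 * v 1 + 2 * c8 * v 2)
    (h11 : a11 = 2 * c3 * v 0 + 6 * c4 * v 1 + 2 * c7 * v 2)
    (h12 : a12 = c6 * v 0 + 2 * c7 * v 1 + 2 * c9 * v 2)
    (h22 : a22 = 2 * c8 * v 0 + 2 * c9 * v 1 + 6 * c10 * v 2) :
    eval v (hessianDet (cub c1 c2 c3 c4 c5 c6 c7 c8 c9 c10)) =
      a00 * (a11 * a22 - a12 * a12) - a01 * (a01 * a22 - a12 * a02)
        + a02 * (a01 * a12 - a11 * a02) := by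
  have d01 : pderiv (0 : Fin 3) (X 1 : MvPolynomial (Fin 3) ℂ) = 0 := pderiv_X_of_ne (by decide)
  have d02 : pderiv (0 : Fin 3) (X 2 : MvPolynomial (Fin 3) ℂ) = 0 := pderiv_X_of_ne (by decide)
  have d10 : pderiv (1 : Fin 3) (X 0 : MvPolynomial (Fin 3) ℂ) = 0 := pderiv_X_of_ne (by decide)
  have d12 : pderiv (1 : Fin 3) (X 2 : MvPolynomial (Fin 3) ℂ) = 0 := pderiv_X_of_ne (by decide)
  have d20 : pderiv (2 : Fin 3) (X 0 : MvPolynomial (Fin 3) ℂ) = 0 := pderiv_X_of_ne (by decide)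
  have d21 : pderiv (2 : Fin 3) (X 1 : MvPolynomial (Fin 3) ℂ) = 0 := pderiv_X_of_ne (by decide)
  unfold hessianDet
  rw [Matrix.det_fin_three]
  simp only [Matrix.of_apply, cub, map_add, Derivation.leibniz, pderiv_C, pderiv_X_self, d01, d02,
    d10, d12, d20, d21, smul_eq_mul, mul_zero, zero_mul, add_zero, zero_add, mul_one, map_mul,
    map_sub, eval_C, eval_X, map_one, map_zero, Derivation.map_one_eq_zero]
  subst h00 h01 h02 h11 h12 h22
  ring

lemma hesse_eq (l : ℂ) : hesseCubic l = cub 1 0 0 1 0 l 0 0 0 1 := by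
  apply MvPolynomial.funext
  intro v
  rw [eval_cub]
  simp [hesseCubic]
  ring

lemma hesse_hom (l : ℂ) : (hesseCubic l).IsHomogeneous 3 := by
  rw [hesse_eq]; apply cub_hom

lemma orbit_sub : orbitImage ⊆ FlexVariety := by
  rintro z ⟨M, l, hx, ha, rfl⟩
  refine ⟨_, hx, _, ha, rfl, ?_⟩
  rw [cubicOf_coeffVec _ (linearSubst_hom _ _ _ (hesse_hom l)), hessianDet_linearSubst, map_mul,
    eval_linearSubst, eval_linearSubst]
  have h : (↑M⁻¹ : Matrix (Fin 3) (Fin 3) ℂ) *ᵥ ((↑M : Matrix (Fin 3) (Fin 3) ℂ) *ᵥ qvec)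
      = qvec := by
    rw [Matrix.mulVec_mulVec, ← Units.val_mul, inv_mul_cancel]; simp
  rw [h, hesse_eq, eval_cub, eval_hess_cub _ _ _ _ _ _ _ _ _ _ _ _ _ _ _ _ _ rfl rfl rfl rfl rfl rfl]
  simp [qvec]
  exact ⟨by norm_num, Or.inr (by ring)⟩

/-- `P` vanishes on all vector representatives of the points of the orbit image. -/
def VanS (P : MvPolynomial Vars ℂ) : Prop :=
  ∀ (M : GL (Fin 3) ℂ) (l c1 c2 : ℂ), c1 ≠ 0 → c2 ≠ 0 →
    eval (Sum.elim (c1 • ((↑M : Matrix (Fin 3) (Fin 3) ℂ) *ᵥ qvec))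
      (c2 • coeffVec (linearSubst (↑M⁻¹ : Matrix (Fin 3) (Fin 3) ℂ) (hesseCubic l)))) P = 0

/-- The pair `(x, f)` lies in the closure of the orbit image. -/
def InCl (x : Fin 3 → ℂ) (f : MvPolynomial (Fin 3) ℂ) : Prop :=
  ∀ P : MvPolynomial Vars ℂ, VanS P → eval (Sum.elim x (coeffVec f)) P = 0

lemma linearSubst_inj (A B : Matrix (Fin 3) (Fin 3) ℂ) (h : A * B = 1)
    (f : MvPolynomial (Fin 3) ℂ) : linearSubst B (linearSubst A f) = f := by
  rw [linearSubst_mul, h, linearSubst_one]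

lemma coeffVec_ne (f : MvPolynomial (Fin 3) ℂ) (hf : f.IsHomogeneous 3) (h0 : f ≠ 0) :
    coeffVec f ≠ 0 := by
  intro h
  apply h0
  rw [← cubicOf_coeffVec f hf, h]
  simp [cubicOf]

lemma vanS_of (P : MvPolynomial Vars ℂ) (h : VanishesOn P orbitImage) : VanS P := by
  intro M l c1 c2 h1 h2
  have e1 : (↑M⁻¹ : Matrix (Fin 3) (Fin 3) ℂ) * (↑M : Matrix (Fin 3) (Fin 3) ℂ) = 1 := by
    rw [← Units.val_mul, inv_mul_cancel]; rfl
  have hq : qvec ≠ 0 := by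
    intro h
    have := congrFun h 2
    simp [qvec] at this
  have hx : (↑M : Matrix (Fin 3) (Fin 3) ℂ) *ᵥ qvec ≠ 0 := by
    intro h
    apply hq
    have := congrArg (fun v => (↑M⁻¹ : Matrix (Fin 3) (Fin 3) ℂ) *ᵥ v) h
    simpa [Matrix.mulVec_mulVec, e1] using this
  have hh : hesseCubic l ≠ 0 := by
    intro h
    have := congrArg (eval ![1, 0, 0]) h
    rw [hesse_eq, eval_cub] at this
    simp at this
  have ha : coeffVec (linearSubst (↑M⁻¹ : Matrix (Fin 3) (Fin 3) ℂ) (hesseCubic l)) ≠ 0 := by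
    apply coeffVec_ne _ (linearSubst_hom _ _ _ (hesse_hom l))
    intro h
    apply hh
    rw [← linearSubst_inj _ _ e1 (hesseCubic l), h]
    simp [linearSubst]
  apply h _ (smul_ne_zero h1 hx) _ (smul_ne_zero h2 ha)
  refine ⟨M, l, hx, ha, ?_⟩
  rw [Prod.mk.injEq]
  exact ⟨(Projectivization.mk_eq_mk_iff' ℂ _ _ _ _).2 ⟨c1, rfl⟩,
    (Projectivization.mk_eq_mk_iff' ℂ _ _ _ _).2 ⟨c2, rfl⟩⟩

/-- pulling back a polynomial along a linear map of coordinates -/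
lemma exists_pullback (P : MvPolynomial Vars ℂ) (A : (Fin 3 → ℂ) →ₗ[ℂ] (Fin 3 → ℂ))
    (B : (Sym (Fin 3) 3 → ℂ) →ₗ[ℂ] (Sym (Fin 3) 3 → ℂ)) :
    ∃ Q : MvPolynomial Vars ℂ, ∀ x a, eval (Sum.elim x a) Q = eval (Sum.elim (A x) (B a)) P := by
  classical
  refine ⟨bind₁ (Sum.elim (fun i => ∑ j, C (LinearMap.toMatrix' A i j) * X (Sum.inl j))
    (fun i => ∑ j, C (LinearMap.toMatrix' B i j) * X (Sum.inr j))) P, fun x a => ?_⟩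
  rw [← coe_aeval_eq_eval, ← coe_aeval_eq_eval, RingHom.coe_coe, RingHom.coe_coe, aeval_bind₁]
  congr 2
  funext s
  rcases s with i | i
  · simp only [Sum.elim_inl, map_sum, map_mul, aeval_X, algHom_C]
    have := congrFun (LinearMap.toMatrix'_mulVec A x) i
    rw [← this]
    simp [Matrix.mulVec, dotProduct]
  · simp only [Sum.elim_inr, map_sum, map_mul, aeval_X, algHom_C]
    have := congrFun (LinearMap.toMatrix'_mulVec B a) i
    rw [← this]
    simp [Matrix.mulVec, dotProduct]

lemma inCl_scale (x : Fin 3 → ℂ) (f : MvPolynomial (Fin 3) ℂ) (c1 c2 : ℂ) (h1 : c1 ≠ 0)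
    (h2 : c2 ≠ 0) (h : InCl x f) : InCl (c1 • x) (C c2 * f) := by
  intro P hP
  obtain ⟨Q, hQ⟩ := exists_pullback P (c1 • LinearMap.id) (c2 • LinearMap.id)
  have := h Q (by
    intro M l d1 d2 hd1 hd2
    rw [hQ]
    have := hP M l (d1 * c1) (d2 * c2) (mul_ne_zero hd1 h1) (mul_ne_zero hd2 h2)
    simpa [smul_smul] using this)
  rw [hQ] at this
  rw [coeffVec_C_mul]
  simpa using this

/-- The linear map on coefficient vectors induced by a substitution. -/
noncomputable def substMap (A : Matrix (Fin 3) (Fin 3) ℂ) :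
    (Sym (Fin 3) 3 → ℂ) →ₗ[ℂ] (Sym (Fin 3) 3 → ℂ) where
  toFun a := coeffVec (linearSubst A (cubicOf a))
  map_add' a b := by
    rw [← coeffVec_add]
    congr 1
    simp [linearSubst, cubicOf, add_mul, Finset.sum_add_distrib]
  map_smul' c a := by
    rw [RingHom.id_apply, ← coeffVec_C_mul, ← linearSubst_C_mul]
    congr 2
    simp [cubicOf, Finset.mul_sum, mul_assoc]

lemma inCl_act (A : Matrix (Fin 3) (Fin 3) ℂ) (hA : A.det ≠ 0) (x : Fin 3 → ℂ)
    (g : MvPolynomial (Fin 3) ℂ) (hg : g.IsHomogeneous 3) (h : InCl (A *ᵥ x) g) :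
    InCl x (linearSubst A g) := by
  intro P hP
  obtain ⟨Q, hQ⟩ := exists_pullback P (Matrix.mulVecLin A⁻¹) (substMap A)
  have hu : IsUnit A.det := isUnit_iff_ne_zero.2 hA
  have := h Q (by
    intro M l d1 d2 hd1 hd2
    rw [hQ]
    let N : GL (Fin 3) ℂ := Matrix.GeneralLinearGroup.mkOfDetNeZero A hA
    have hN : (↑N : Matrix (Fin 3) (Fin 3) ℂ) = A := rfl
    have hN' : (↑N⁻¹ : Matrix (Fin 3) (Fin 3) ℂ) = A⁻¹ := by
      rw [Matrix.coe_units_inv, hN]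
    have := hP (N⁻¹ * M) l d1 d2 hd1 hd2
    rw [_root_.mul_inv_rev, inv_inv, Units.val_mul, Units.val_mul, hN, hN', ← linearSubst_mul,
      ← Matrix.mulVec_mulVec] at this
    rw [map_smul, map_smul]
    have e : substMap A (coeffVec (linearSubst (↑M⁻¹ : Matrix (Fin 3) (Fin 3) ℂ) (hesseCubic l)))
        = coeffVec (linearSubst A (linearSubst (↑M⁻¹ : Matrix (Fin 3) (Fin 3) ℂ)
          (hesseCubic l))) := by
      change coeffVec (linearSubst A (cubicOf _)) = _
      rw [cubicOf_coeffVec _ (linearSubst_hom _ _ _ (hesse_hom l))]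
    rw [e]
    exact this)
  rw [hQ] at this
  have e : substMap A (coeffVec g) = coeffVec (linearSubst A g) := by
    change coeffVec (linearSubst A (cubicOf _)) = _
    rw [cubicOf_coeffVec _ hg]
  rw [e, Matrix.mulVecLin_apply, Matrix.mulVec_mulVec, Matrix.nonsing_inv_mul _ hu,
    Matrix.one_mulVec] at this
  exact this

lemma inCl_act' (A : Matrix (Fin 3) (Fin 3) ℂ) (hA : A.det ≠ 0) (x y : Fin 3 → ℂ)
    (f : MvPolynomial (Fin 3) ℂ) (hf : f.IsHomogeneous 3) (hxy : A *ᵥ y = x)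
    (h : InCl y (linearSubst A f)) : InCl x f := by
  have hu : IsUnit A.det := isUnit_iff_ne_zero.2 hA
  have := inCl_act A⁻¹ (by rw [Matrix.det_nonsing_inv]; simpa using hA) x (linearSubst A f)
    (linearSubst_hom _ _ _ hf) (by
      rw [← hxy, Matrix.mulVec_mulVec, Matrix.nonsing_inv_mul _ hu, Matrix.one_mulVec]; exact h)
  rwa [linearSubst_inj _ _ (Matrix.mul_nonsing_inv _ hu)] at this

lemma inCl_line (x : Fin 3 → ℂ) (f g : MvPolynomial (Fin 3) ℂ) (S : Set ℂ) (hS : S.Finite)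
    (h : ∀ t : ℂ, t ∉ S → InCl x (f + C t * g)) : InCl x f := by
  intro P hP
  let p : Polynomial ℂ := aeval (Sum.elim (fun i => Polynomial.C (x i))
    (fun m => Polynomial.C (coeffVec f m) + Polynomial.X * Polynomial.C (coeffVec g m))) P
  have hp : ∀ t : ℂ, p.eval t = eval (Sum.elim x (coeffVec (f + C t * g))) P := by
    intro t
    rw [← Polynomial.coe_evalRingHom, ← coe_aeval_eq_eval, RingHom.coe_coe]
    have h1 : p.eval t = (Polynomial.aeval t) p := by simp
    rw [Polynomial.coe_evalRingHom, h1]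
    change ((Polynomial.aeval t).comp (aeval _)) P = _
    rw [comp_aeval]
    congr 2
    funext s
    rcases s with i | i
    · simp
    · simp [coeffVec_add, coeffVec_C_mul]
      ring
  have h0 : p = 0 := by
    apply Polynomial.eq_zero_of_infinite_isRoot
    apply hS.infinite_compl.mono
    intro t ht
    change p.eval t = 0
    rw [hp]
    exact h t ht P hP
  have := hp 0
  rw [h0] at this
  simpa using this.symm


lemma mv3 (A : Matrix (Fin 3) (Fin 3) ℂ) (v : Fin 3 → ℂ) (i : Fin 3) :
    (A *ᵥ v) i = A i 0 * v 0 + A i 1 * v 1 + A i 2 * v 2 := by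
  simp [Matrix.mulVec, dotProduct, Fin.sum_univ_three]

lemma vec3_ext (v w : Fin 3 → ℂ) (h0 : v 0 = w 0) (h1 : v 1 = w 1) (h2 : v 2 = w 2) : v = w := by
  funext i
  fin_cases i
  · exact h0
  · exact h1
  · exact h2

lemma inCl_q (l : ℂ) : InCl qvec (hesseCubic l) := by
  intro P hP
  have := hP 1 l 1 1 one_ne_zero one_ne_zero
  simpa [linearSubst_one] using this

lemma inCl_S1 (k : ℂ) (hk : 1 + 27 * k ≠ 0) :
    InCl ![0, 1, -1] (cub k (3 * k) (3 * k) k (3 * k) (1 + 6 * k) (3 * k) (3 * k) (3 * k) k) := by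
  obtain ⟨r, hr⟩ := IsAlgClosed.exists_pow_nat_eq (1 + 27 * k) (n := 3) (by norm_num)
  have hr0 : r ≠ 0 := by
    rintro rfl
    apply hk
    rw [← hr]; norm_num
  obtain ⟨d, hd⟩ := IsAlgClosed.exists_pow_nat_eq (-3 : ℂ) (n := 2) (by norm_num)
  have hd0 : d ≠ 0 := by
    rintro rfl
    norm_num at hd
  obtain ⟨w, hw⟩ : ∃ w : ℂ, w = (-1 + d) / 2 := ⟨_, rfl⟩
  have hw1 : w ^ 2 + w + 1 = 0 := by
    rw [hw]; linear_combination hd / 4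
  have hw2 : 2 * w + 1 ≠ 0 := by
    rw [hw]; ring_nf; exact hd0
  let A : Matrix (Fin 3) (Fin 3) ℂ :=
    !![r / 3, r / 3, r / 3; 1 / 3, (-1 - w) / 3, w / 3; 1 / 3, w / 3, (-1 - w) / 3]
  have hA : A.det ≠ 0 := by
    have : A.det = r * (2 * w + 1) / 9 := by
      rw [Matrix.det_fin_three]; simp [A]; ring
    rw [this]
    exact div_ne_zero (mul_ne_zero hr0 hw2) (by norm_num)
  have hs : r * r⁻¹ = 1 := mul_inv_cancel₀ hr0
  generalize r⁻¹ = s at hs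
  have e : linearSubst A (hesseCubic (-3 * s)) =
      cub k (3 * k) (3 * k) k (3 * k) (1 + 6 * k) (3 * k) (3 * k) (3 * k) k := by
    apply MvPolynomial.funext
    intro v
    rw [eval_linearSubst, hesse_eq, eval_cub, eval_cub, mv3, mv3, mv3]
    simp only [A, Matrix.of_apply, Matrix.cons_val', Matrix.cons_val_zero, Matrix.cons_val_one,
      Matrix.cons_val_two, Matrix.head_cons, Matrix.tail_cons]
    generalize v 0 = x
    generalize v 1 = y
    generalize v 2 = z
    linear_combination (x + y + z) ^ 3 / 27 * hr
      - (x + y + z) * ((x + (-1 - w) * y + w * z) / 3) * ((x + w * y + (-1 - w) * z) / 3) * hs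
      + x * (y - z) ^ 2 / 3 * hw1
  rw [← e]
  apply inCl_act A hA _ _ (hesse_hom _)
  have e2 : A *ᵥ ![0, 1, -1] = ((2 * w + 1) / 3) • qvec := by
    apply vec3_ext <;> rw [mv3] <;> simp [A, qvec] <;> ring
  rw [e2]
  have := inCl_scale _ _ ((2 * w + 1) / 3) 1 (div_ne_zero hw2 (by norm_num)) one_ne_zero
    (inCl_q (-3 * s))
  simpa using this

lemma inCl_S2 (a b : ℂ) (ha : a ≠ 0) (hD : 4 * a ^ 3 + 27 * b ^ 2 ≠ 0) :
    InCl ![0, 0, 1] (cub 1 0 a b 0 0 0 0 1 0) := by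
  obtain ⟨t, ht⟩ : ∃ t : ℂ, 3 * t ^ 4 + 6 * a * t ^ 2 - 12 * b * t - a ^ 2 = 0 := by
    let p : Polynomial ℂ := 3 * Polynomial.X ^ 4 + Polynomial.C (6 * a) * Polynomial.X ^ 2
      - Polynomial.C (12 * b) * Polynomial.X - Polynomial.C (a ^ 2)
    have hp : p.degree = 4 := by
      simp only [p]
      rw [← map_ofNat Polynomial.C 3]
      compute_degree!
    obtain ⟨t, ht⟩ := IsAlgClosed.exists_root p (by rw [hp]; norm_num)
    refine ⟨t, ?_⟩
    have : p.eval t = 0 := ht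
    simpa [p] using this
  have ht0 : t ≠ 0 := by
    rintro rfl
    apply ha
    simpa using ht
  obtain ⟨u, h1⟩ := IsAlgClosed.exists_pow_nat_eq (3 * t) (n := 2) (by norm_num)
  have hu0 : u ≠ 0 := by
    rintro rfl
    apply ht0
    simpa using h1.symm
  obtain ⟨w, h4⟩ : ∃ w : ℂ, 2 * u * w = 1 := ⟨1 / (2 * u), by field_simp⟩
  obtain ⟨v, hv⟩ : ∃ v : ℂ, v = (3 * t ^ 2 - a) * w := ⟨_, rfl⟩
  have h2 : 2 * u * v = 3 * t ^ 2 - a := by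
    rw [hv]; linear_combination (3 * t ^ 2 - a) * h4
  have h3 : v ^ 2 = t ^ 3 - b := by
    have : 12 * t * (v ^ 2 - (t ^ 3 - b)) = 0 := by
      linear_combination (2 * u * v + (3 * t ^ 2 - a)) * h2 - 4 * v ^ 2 * h1 - ht
    have h12 : (12 * t : ℂ) ≠ 0 := mul_ne_zero (by norm_num) ht0
    exact sub_eq_zero.1 ((mul_eq_zero.1 this).resolve_left h12)
  have hw0 : w ≠ 0 := by
    rintro rfl
    simp at h4
  obtain ⟨c, hc⟩ : ∃ c : ℂ, c = t - 2 * w * v := ⟨_, rfl⟩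
  have hcu : c * u = t * u - v := by
    rw [hc]; linear_combination -v * h4
  have hc0 : c ≠ 0 := by
    rintro rfl
    have e1 : v = t * u := by linear_combination hcu
    have e2 : a = -3 * t ^ 2 := by
      rw [e1] at h2
      linear_combination - 2 * t * h1 + h2
    have e3 : b = -2 * t ^ 3 := by
      rw [e1] at h3
      linear_combination h3 - t ^ 2 * h1
    apply hD
    rw [e2, e3]; ring
  have hk : 1 + 27 * (-c * w ^ 2) ≠ 0 := by
    intro h
    have e0 : 4 * u ^ 2 - 27 * c = 0 := by
      linear_combination 4 * u ^ 2 * h + 27 * c * (2 * u * w + 1) * h4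
    have e1 : 3 * a = - t ^ 2 := by
      linear_combination (2 / 9) * (- u ^ 2 * e0 - 27 * u * hcu) + 3 * h2 + (8 / 9 * u ^ 2 + 8 / 3 * t - 6 * t) * h1
    have e2 : v * u = 5 / 3 * t ^ 2 := by
      linear_combination h2 / 2 - e1 / 6
    have e3 : 27 * b = 2 * t ^ 3 := by
      have : t * (27 * b - 2 * t ^ 3) = 0 := by
        linear_combination 27 * t * h3 + 9 * v ^ 2 * h1 - 9 * (v * u + 5 / 3 * t ^ 2) * e2
      exact sub_eq_zero.1 ((mul_eq_zero.1 this).resolve_left ht0)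
    apply hD
    have e4 : a = - t ^ 2 / 3 := by linear_combination e1 / 3
    have e5 : b = 2 * t ^ 3 / 27 := by linear_combination e3 / 27
    rw [e4, e5]; ring
  let A : Matrix (Fin 3) (Fin 3) ℂ := !![0, c, 0; 1 / 2, w * v, -w; 1 / 2, w * v, w]
  have hA : A.det ≠ 0 := by
    have : A.det = - c * w := by
      rw [Matrix.det_fin_three]; simp [A]; ring
    rw [this]
    exact mul_ne_zero (neg_ne_zero.2 hc0) hw0
  have hkk : -c * w ^ 2 ≠ 0 := mul_ne_zero (neg_ne_zero.2 hc0) (pow_ne_zero _ hw0)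
  have base := inCl_S1 _ hk
  have base2 := inCl_scale _ _ (-w) 1 (neg_ne_zero.2 hw0) one_ne_zero base
  rw [C_1, one_mul] at base2
  have e2 : A *ᵥ ![0, 0, 1] = (-w) • ![0, 1, -1] := by
    apply vec3_ext <;> rw [mv3] <;> simp [A]
  rw [← e2] at base2
  have base3 := inCl_act A hA _ _ (cub_hom _ _ _ _ _ _ _ _ _ _) base2
  have base4 := inCl_scale _ _ 1 (-c * w ^ 2)⁻¹ one_ne_zero (inv_ne_zero hkk) base3
  rw [one_smul] at base4
  convert base4 using 1
  apply MvPolynomial.funext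
  intro x
  rw [map_mul, eval_linearSubst, eval_C, eq_inv_mul_iff_mul_eq₀ hkk, eval_cub, eval_cub, mv3, mv3,
    mv3]
  simp only [A, Matrix.of_apply, Matrix.cons_val', Matrix.cons_val_zero, Matrix.cons_val_one,
      Matrix.cons_val_two, Matrix.head_cons, Matrix.tail_cons]
  generalize x 0 = X
  generalize x 1 = Y
  generalize x 2 = Z
  have hm : t = c + 2 * w * v := by rw [hc]; ring
  have hfin : (-c * w ^ 2) * (X + t * Y) ^ 3 + c * Y * ((X / 2 + w * v * Y) ^ 2 - w ^ 2 * Z ^ 2)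
      = (-c * w ^ 2) * (X ^ 3 + Y * Z ^ 2 + a * X * Y ^ 2 + b * Y ^ 3) := by
    linear_combination (-c * w ^ 2) * (- X ^ 2 * Y * h1 - X * Y ^ 2 * h2 - Y ^ 3 * h3)
      - c * Y / 2 * ((w * u + 1 / 2) * X ^ 2 + 2 * w * v * X * Y) * h4
  rw [hm] at hfin
  linear_combination -hfin

lemma inCl_S3 (a b : ℂ) : InCl ![0, 0, 1] (cub 1 0 a b 0 0 0 0 1 0) := by
  let p : Polynomial ℂ := (Polynomial.C a + Polynomial.X) *
    (4 * (Polynomial.C a + Polynomial.X) ^ 3 + Polynomial.C (27 * b ^ 2))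
  have hp : p ≠ 0 := by
    intro h
    have h1 := congrArg (Polynomial.eval (1 - a)) h
    have h2 := congrArg (Polynomial.eval (2 - a)) h
    simp [p] at h1 h2
    have : (56 : ℂ) = 0 := by linear_combination 2 * h2 - 2 * h1
    norm_num at this
  apply inCl_line _ _ (cub 0 0 1 0 0 0 0 0 0 0) {t | p.IsRoot t}
    (Polynomial.finite_setOfPred_isRoot hp)
  intro t ht
  have ht' : (a + t) * (4 * (a + t) ^ 3 + 27 * b ^ 2) ≠ 0 := by
    intro h
    apply ht
    change p.eval t = 0
    simpa [p] using h
  have := inCl_S2 (a + t) b (left_ne_zero_of_mul ht') (right_ne_zero_of_mul ht')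
  convert this using 1
  apply MvPolynomial.funext
  intro v
  rw [map_add, map_mul, eval_cub, eval_cub, eval_cub, eval_C]
  ring

lemma inCl_S4 (k0 k2 k3 c : ℂ) (hk : k0 ≠ 0) (hc : c ≠ 0) :
    InCl ![0, 0, 1] (cub k0 0 k2 k3 0 0 0 0 c 0) := by
  obtain ⟨g, hg⟩ := IsAlgClosed.exists_pow_nat_eq (k0 / c) (n := 2) (by norm_num)
  have hg0 : g ≠ 0 := by
    rintro rfl
    have : k0 / c ≠ 0 := div_ne_zero hk hc
    apply this
    rw [← hg]; simp
  have hg' : c * g ^ 2 = k0 := by rw [hg]; field_simp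
  let A : Matrix (Fin 3) (Fin 3) ℂ := !![1, 0, 0; 0, 1, 0; 0, 0, g]
  have hA : A.det ≠ 0 := by
    have : A.det = g := by
      rw [Matrix.det_fin_three]; simp [A]
    rwa [this]
  apply inCl_act' A hA _ (g⁻¹ • ![0, 0, 1]) _ (cub_hom _ _ _ _ _ _ _ _ _ _)
  · apply vec3_ext <;> rw [mv3] <;> simp [A, hg0]
  have := inCl_scale _ _ g⁻¹ k0 (inv_ne_zero hg0) hk (inCl_S3 (k2 / k0) (k3 / k0))
  convert this using 1
  apply MvPolynomial.funext
  intro v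
  rw [map_mul, eval_linearSubst, eval_C, eval_cub, eval_cub, mv3, mv3, mv3]
  simp only [A, Matrix.of_apply, Matrix.cons_val', Matrix.cons_val_zero, Matrix.cons_val_one,
      Matrix.cons_val_two, Matrix.head_cons, Matrix.tail_cons]
  have e1 : k0 * (k2 / k0) = k2 := by field_simp
  have e2 : k0 * (k3 / k0) = k3 := by field_simp
  linear_combination v 1 * v 2 ^ 2 * hg' - v 0 * v 1 ^ 2 * e1 - v 1 ^ 3 * e2

lemma inCl_S5 (k0 k1 k2 k3 c : ℂ) (hk : k0 ≠ 0) (hc : c ≠ 0) :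
    InCl ![0, 0, 1] (cub k0 k1 k2 k3 0 0 0 0 c 0) := by
  obtain ⟨s, hs⟩ : ∃ s : ℂ, 3 * k0 * s = k1 := ⟨k1 / (3 * k0), by field_simp⟩
  let A : Matrix (Fin 3) (Fin 3) ℂ := !![1, -s, 0; 0, 1, 0; 0, 0, 1]
  have hA : A.det ≠ 0 := by
    have : A.det = 1 := by
      rw [Matrix.det_fin_three]; simp [A]
    rw [this]; exact one_ne_zero
  apply inCl_act' A hA _ ![0, 0, 1] _ (cub_hom _ _ _ _ _ _ _ _ _ _)
  · apply vec3_ext <;> rw [mv3] <;> simp [A]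
  have := inCl_S4 k0 (3 * k0 * s ^ 2 - 2 * k1 * s + k2)
    (- k0 * s ^ 3 + k1 * s ^ 2 - k2 * s + k3) c hk hc
  convert this using 1
  apply MvPolynomial.funext
  intro v
  rw [eval_linearSubst, eval_cub, eval_cub, mv3, mv3, mv3]
  simp only [A, Matrix.of_apply, Matrix.cons_val', Matrix.cons_val_zero, Matrix.cons_val_one,
      Matrix.cons_val_two, Matrix.head_cons, Matrix.tail_cons]
  linear_combination - v 0 ^ 2 * v 1 * hs

lemma inCl_S6 (k0 k1 k2 k3 a b c : ℂ) (hk : k0 ≠ 0) (hc : c ≠ 0) :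
    InCl ![0, 0, 1] (cub k0 k1 k2 k3 0 a b 0 c 0) := by
  obtain ⟨p, hp⟩ : ∃ s : ℂ, 2 * c * s = a := ⟨a / (2 * c), by field_simp⟩
  obtain ⟨r, hr⟩ : ∃ s : ℂ, 2 * c * s = b := ⟨b / (2 * c), by field_simp⟩
  let A : Matrix (Fin 3) (Fin 3) ℂ := !![1, 0, 0; 0, 1, 0; -p, -r, 1]
  have hA : A.det ≠ 0 := by
    have : A.det = 1 := by
      rw [Matrix.det_fin_three]; simp [A]
    rw [this]; exact one_ne_zero
  apply inCl_act' A hA _ ![0, 0, 1] _ (cub_hom _ _ _ _ _ _ _ _ _ _)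
  · apply vec3_ext <;> rw [mv3] <;> simp [A]
  have := inCl_S5 k0 (k1 - c * p ^ 2) (k2 - 2 * c * p * r) (k3 - c * r ^ 2) c hk hc
  convert this using 1
  apply MvPolynomial.funext
  intro v
  rw [eval_linearSubst, eval_cub, eval_cub, mv3, mv3, mv3]
  simp only [A, Matrix.of_apply, Matrix.cons_val', Matrix.cons_val_zero, Matrix.cons_val_one,
      Matrix.cons_val_two, Matrix.head_cons, Matrix.tail_cons]
  subst hp hr
  ring

lemma inCl_S7 (k0 k1 k2 k3 a b c : ℂ) :
    InCl ![0, 0, 1] (cub k0 k1 k2 k3 0 a b 0 c 0) := by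
  apply inCl_line _ _ (cub 1 0 0 0 0 0 0 0 1 0) {-k0, -c} (Set.toFinite _)
  intro t ht
  simp only [Set.mem_insert_iff, Set.mem_singleton_iff, not_or] at ht
  have := inCl_S6 (k0 + t) k1 k2 k3 a b (c + t)
    (fun h => ht.1 (by linear_combination h)) (fun h => ht.2 (by linear_combination h))
  convert this using 1
  apply MvPolynomial.funext
  intro v
  rw [map_add, map_mul, eval_cub, eval_cub, eval_cub, eval_C]
  ring

lemma exists_dir (b c q1 q2 q3 : ℂ) (h : q1 * c ^ 2 - q2 * b * c + q3 * b ^ 2 = 0) :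
    ∃ p s : ℂ, (p ≠ 0 ∨ s ≠ 0) ∧ b * p + c * s = 0 ∧ q1 * p ^ 2 + q2 * p * s + q3 * s ^ 2 = 0 := by
  by_cases hbc : c ≠ 0 ∨ b ≠ 0
  · refine ⟨c, -b, ?_, by ring, by linear_combination h⟩
    rcases hbc with h | h
    · exact Or.inl h
    · exact Or.inr (neg_ne_zero.2 h)
  · simp only [ne_eq, not_or, not_not] at hbc
    obtain ⟨rfl, rfl⟩ := hbc
    by_cases hq : q1 = 0
    · exact ⟨1, 0, Or.inl one_ne_zero, by ring, by rw [hq]; ring⟩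
    · obtain ⟨d, hd⟩ := IsAlgClosed.exists_pow_nat_eq (q2 ^ 2 - 4 * q1 * q3) (n := 2) (by norm_num)
      refine ⟨(d - q2), 2 * q1, Or.inr (mul_ne_zero two_ne_zero hq), by ring, ?_⟩
      linear_combination q1 * hd

lemma inCl_S8 (c1 c2 c3 c4 c5 c6 c7 c8 c9 : ℂ)
    (h : c5 * c9 ^ 2 - c6 * c8 * c9 + c7 * c8 ^ 2 = 0) :
    InCl ![0, 0, 1] (cub c1 c2 c3 c4 c5 c6 c7 c8 c9 0) := by
  obtain ⟨p, s, hps, hl, hq⟩ := exists_dir _ _ _ _ _ h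
  obtain ⟨r, w, hd⟩ : ∃ r w : ℂ, p * w - r * s ≠ 0 := by
    rcases hps with h | h
    · exact ⟨0, 1, by simpa using h⟩
    · exact ⟨1, 0, by simpa using h⟩
  let A : Matrix (Fin 3) (Fin 3) ℂ := !![p, r, 0; s, w, 0; 0, 0, 1]
  have hA : A.det ≠ 0 := by
    have : A.det = p * w - r * s := by
      rw [Matrix.det_fin_three]; simp [A]
    rwa [this]
  apply inCl_act' A hA _ ![0, 0, 1] _ (cub_hom _ _ _ _ _ _ _ _ _ _)
  · apply vec3_ext <;> rw [mv3] <;> simp [A]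
  have := inCl_S7 (c1 * p ^ 3 + c2 * p ^ 2 * s + c3 * p * s ^ 2 + c4 * s ^ 3)
    (3 * c1 * p ^ 2 * r + c2 * (p ^ 2 * w + 2 * p * r * s) + c3 * (r * s ^ 2 + 2 * p * s * w)
      + 3 * c4 * s ^ 2 * w)
    (3 * c1 * p * r ^ 2 + c2 * (r ^ 2 * s + 2 * p * r * w) + c3 * (p * w ^ 2 + 2 * r * s * w)
      + 3 * c4 * s * w ^ 2)
    (c1 * r ^ 3 + c2 * r ^ 2 * w + c3 * r * w ^ 2 + c4 * w ^ 3)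
    (2 * c5 * p * r + c6 * (p * w + r * s) + 2 * c7 * s * w)
    (c5 * r ^ 2 + c6 * r * w + c7 * w ^ 2) (c8 * r + c9 * w)
  convert this using 1
  apply MvPolynomial.funext
  intro v
  rw [eval_linearSubst, eval_cub, eval_cub, mv3, mv3, mv3]
  simp only [A, Matrix.of_apply, Matrix.cons_val', Matrix.cons_val_zero, Matrix.cons_val_one,
      Matrix.cons_val_two, Matrix.head_cons, Matrix.tail_cons]
  linear_combination v 0 ^ 2 * v 2 * hq + v 0 * v 2 ^ 2 * hl

lemma exists_frame (x : Fin 3 → ℂ) (hx : x ≠ 0) :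
    ∃ A : Matrix (Fin 3) (Fin 3) ℂ, A.det ≠ 0 ∧ A *ᵥ ![0, 0, 1] = x := by
  by_cases h2 : x 2 = 0
  · by_cases h1 : x 1 = 0
    · have h0 : x 0 ≠ 0 := fun h0 => hx (vec3_ext _ _ h0 h1 h2)
      refine ⟨!![0, 0, x 0; 0, 1, x 1; 1, 0, x 2], ?_, ?_⟩
      · rw [Matrix.det_fin_three]; simpa using h0
      · apply vec3_ext <;> rw [mv3] <;> simp
    · refine ⟨!![1, 0, x 0; 0, 0, x 1; 0, 1, x 2], ?_, ?_⟩
      · rw [Matrix.det_fin_three]; simpa using h1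
      · apply vec3_ext <;> rw [mv3] <;> simp
  · refine ⟨!![1, 0, x 0; 0, 1, x 1; 0, 0, x 2], ?_, ?_⟩
    · rw [Matrix.det_fin_three]; simpa using h2
    · apply vec3_ext <;> rw [mv3] <;> simp

lemma inCl_flex (x : Fin 3 → ℂ) (hx : x ≠ 0) (f : MvPolynomial (Fin 3) ℂ)
    (hf : f.IsHomogeneous 3) (h1 : eval x f = 0) (h2 : eval x (hessianDet f) = 0) :
    InCl x f := by
  obtain ⟨A, hA, rfl⟩ := exists_frame x hx
  apply inCl_act' A hA _ ![0, 0, 1] _ hf rfl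
  have g1 : eval ![0, 0, 1] (linearSubst A f) = 0 := by rw [eval_linearSubst, h1]
  have g2 : eval ![0, 0, 1] (hessianDet (linearSubst A f)) = 0 := by
    rw [hessianDet_linearSubst, map_mul, eval_linearSubst, h2, mul_zero]
  obtain ⟨c1, c2, c3, c4, c5, c6, c7, c8, c9, c10, e⟩ :=
    exists_cub _ (linearSubst_hom A _ _ hf)
  rw [e] at g1 g2 ⊢
  rw [eval_cub] at g1
  have h10 : c10 = 0 := by simpa using g1
  subst h10
  rw [eval_hess_cub _ _ _ _ _ _ _ _ _ _ _ _ _ _ _ _ _ rfl rfl rfl rfl rfl rfl] at g2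
  apply inCl_S8
  simp at g2
  linear_combination - g2 / 8

/-- The morphism `G × 𝔸¹ → X`, `(g, λ) ↦ g(φ(λ))`, where `G = PGL₃(ℂ)`
and `φ(λ) = ((0 : -1 : 1), π(x₁³ + x₂³ + x₃³ + λx₁x₂x₃))`, is a dominant morphism onto the
variety of flexes `X ⊆ P² × P⁹`: its image lies in `X` and is Zariski dense in `X`. -/
theorem stmt5 : IsDenseInFlexVariety orbitImage := by
  refine ⟨orbit_sub, ?_⟩
  intro P m n _ hP x hx a ha hz
  obtain ⟨x', hx', a', ha', he, h1, h2⟩ := hz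
  have h := inCl_flex x' hx' _ (cubicOf_hom a') h1 h2
  rw [Prod.mk.injEq] at he
  obtain ⟨c, hc⟩ := (Projectivization.mk_eq_mk_iff' ℂ _ _ _ _).1 he.1
  obtain ⟨d, hd⟩ := (Projectivization.mk_eq_mk_iff' ℂ _ _ _ _).1 he.2
  have hc0 : c ≠ 0 := by
    rintro rfl
    exact hx (by rw [← hc, zero_smul])
  have hd0 : d ≠ 0 := by
    rintro rfl
    exact ha (by rw [← hd, zero_smul])
  have := inCl_scale _ _ c d hc0 hd0 h P (vanS_of P hP)
  rwa [coeffVec_C_mul, coeffVec_cubicOf, hc, hd] at this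
end

section
/- For every smooth cubic curve C in P² over ℂ, there is a projective linear transformation g ∈ PGL₃(ℂ) mapping C onto a Hesse cubic, i.e., onto the curve defined by the equation x₁³ + x₂³ + x₃³ + λx₁x₂x₃ = 0 for some λ ∈ ℂ. -/
open MvPolynomial Matrix

noncomputable def killVars (k : ℕ) : MvPolynomial (Fin 3) ℂ →ₐ[ℂ] MvPolynomial (Fin 3) ℂ :=
  aeval (fun i : Fin 3 => if (i : ℕ) < k then 0 else X i)

lemma killVars_X (k : ℕ) (i : Fin 3) :
    killVars k (X i) = if (i : ℕ) < k then 0 else X i := by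
  simp [killVars]

lemma killVars_comp (k : ℕ) (p : MvPolynomial (Fin 3) ℂ) :
    killVars (k + 1) (killVars k p) = killVars (k + 1) p := by
  have : (killVars (k + 1)).comp (killVars k) = killVars (k + 1) := by
    apply MvPolynomial.algHom_ext
    intro i
    rw [AlgHom.comp_apply, killVars_X, killVars_X]
    split_ifs with h1 h2 h2
    · simp
    · omega
    · rw [killVars_X, if_pos h2]
    · rw [killVars_X, if_neg h2]
  exact DFunLike.congr_fun this p

lemma killVars_isPrime (k : ℕ) : (RingHom.ker (killVars k)).IsPrime :=
  RingHom.ker_isPrime (killVars k)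

lemma height_killVars (k : ℕ) (hk : k ≤ 3) :
    (k : ℕ∞) ≤ (RingHom.ker (killVars k)).height := by
  induction k with
  | zero => simp
  | succ k ih =>
    have hlt : RingHom.ker (killVars k) < RingHom.ker (killVars (k + 1)) := by
      rw [SetLike.lt_iff_le_and_exists]
      refine ⟨fun p hp => ?_, X ⟨k, by omega⟩, ?_, ?_⟩
      · rw [RingHom.mem_ker] at hp ⊢
        rw [← killVars_comp, hp, map_zero]
      · rw [RingHom.mem_ker, killVars_X, if_pos (by simp)]
      · rw [RingHom.mem_ker, killVars_X, if_neg (by simp)]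
        exact X_ne_zero _
    have := killVars_isPrime k
    have := killVars_isPrime (k + 1)
    have h1 := Ideal.height_add_one_le_of_lt_of_isPrime hlt
    refine le_trans ?_ h1
    push_cast
    gcongr
    exact ih (by omega)

lemma exists_common_zero (f g : MvPolynomial (Fin 3) ℂ) (hf : eval 0 f = 0) (hg : eval 0 g = 0) :
    ∃ v : Fin 3 → ℂ, v ≠ 0 ∧ eval v f = 0 ∧ eval v g = 0 := by
  by_contra hcon
  push Not at hcon
  have hz : zeroLocus ℂ (Ideal.span {f, g}) = {(0 : Fin 3 → ℂ)} := by
    rw [zeroLocus_span]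
    ext v
    simp only [Set.mem_insert_iff, Set.mem_singleton_iff, Set.mem_ofPred_eq, forall_eq_or_imp,
      forall_eq]
    constructor
    · rintro ⟨h1, h2⟩
      by_contra hv
      exact hcon v hv h1 h2
    · rintro rfl
      exact ⟨hf, hg⟩
  have hk : RingHom.ker (killVars 3) = vanishingIdeal ℂ {(0 : Fin 3 → ℂ)} := by
    ext p
    rw [RingHom.mem_ker, mem_vanishingIdeal_singleton_iff]
    have : killVars 3 p = C (eval 0 p) := by
      have : killVars 3 = (Algebra.ofId ℂ (MvPolynomial (Fin 3) ℂ)).comp (aeval 0) := by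
        apply MvPolynomial.algHom_ext
        intro i
        rw [killVars_X, if_pos i.2]
        simp
      rw [this]
      simp [Algebra.ofId_apply, MvPolynomial.algebraMap_eq]
    rw [this, MvPolynomial.aeval_eq_eval]
    simp
  have hr : (Ideal.span {f, g}).radical = RingHom.ker (killVars 3) := by
    rw [hk, ← hz, vanishingIdeal_zeroLocus_eq_radical]
  have := killVars_isPrime 3
  have hmin : RingHom.ker (killVars 3) ∈ (Ideal.span {f, g}).minimalPrimes := by
    rw [← Ideal.radical_minimalPrimes, hr, Ideal.minimalPrimes_eq_subsingleton_self]
    rfl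
  classical
  have h2 : (RingHom.ker (killVars 3)).height ≤ (({f, g} : Finset _).card : ℕ∞) := by
    apply Ideal.height_le_card_of_mem_minimalPrimes_span_finset
    simpa using hmin
  have h3 := height_killVars 3 le_rfl
  have h4 : ({f, g} : Finset (MvPolynomial (Fin 3) ℂ)).card ≤ 2 := Finset.card_le_two
  have h5 := h3.trans h2
  have h6 : 3 ≤ ({f, g} : Finset (MvPolynomial (Fin 3) ℂ)).card := by exact_mod_cast h5
  omega


noncomputable def triCoeff (f : MvPolynomial (Fin 3) ℂ) (i j k : Fin 3) : ℂ :=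
  eval 0 (pderiv k (pderiv j (pderiv i f)))

noncomputable def tri (f : MvPolynomial (Fin 3) ℂ) (u v w : Fin 3 → ℂ) : ℂ :=
  ∑ i, ∑ j, ∑ k, triCoeff f i j k * u i * v j * w k

lemma my_pderiv_comm (i j : Fin 3) (f : MvPolynomial (Fin 3) ℂ) :
    pderiv i (pderiv j f) = pderiv j (pderiv i f) := by
  have : ⁅(pderiv i : Derivation ℂ (MvPolynomial (Fin 3) ℂ) (MvPolynomial (Fin 3) ℂ)),
      (pderiv j : Derivation ℂ (MvPolynomial (Fin 3) ℂ) (MvPolynomial (Fin 3) ℂ))⁆ = 0 := by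
    apply MvPolynomial.derivation_ext
    intro k
    rw [Derivation.commutator_apply, pderiv_X, pderiv_X]
    simp only [Pi.single_apply]
    split_ifs <;> simp
  have h := DFunLike.congr_fun this f
  rw [Derivation.commutator_apply] at h
  exact sub_eq_zero.mp h

lemma eval_pderiv2 (f : MvPolynomial (Fin 3) ℂ) (hf : f.IsHomogeneous 3) (v : Fin 3 → ℂ)
    (i j : Fin 3) : eval v (pderiv j (pderiv i f)) = ∑ k, triCoeff f i j k * v k := by
  have h1 : (pderiv j (pderiv i f)).IsHomogeneous 1 := hf.pderiv.pderiv
  have h := congrArg (eval v) h1.sum_X_mul_pderiv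
  rw [one_smul, map_sum] at h
  rw [← h]
  apply Finset.sum_congr rfl
  intro k _
  have h0 : (pderiv k (pderiv j (pderiv i f))).IsHomogeneous 0 := h1.pderiv
  rw [← totalDegree_zero_iff_isHomogeneous, totalDegree_eq_zero_iff_eq_C] at h0
  rw [triCoeff, h0]
  simp [mul_comm]

lemma eval_pderiv1 (f : MvPolynomial (Fin 3) ℂ) (hf : f.IsHomogeneous 3) (v : Fin 3 → ℂ)
    (i : Fin 3) : 2 * eval v (pderiv i f) = ∑ j, ∑ k, triCoeff f i j k * v j * v k := by
  have h1 : (pderiv i f).IsHomogeneous 2 := hf.pderiv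
  have h := congrArg (eval v) h1.sum_X_mul_pderiv
  rw [map_sum, map_nsmul, nsmul_eq_mul] at h
  push_cast at h
  rw [← h]
  apply Finset.sum_congr rfl
  intro j _
  rw [map_mul, eval_pderiv2 f hf, eval_X, Finset.mul_sum]
  apply Finset.sum_congr rfl
  intro k _
  ring

lemma eval_tri (f : MvPolynomial (Fin 3) ℂ) (hf : f.IsHomogeneous 3) (v : Fin 3 → ℂ) :
    6 * eval v f = tri f v v v := by
  have h := congrArg (eval v) hf.sum_X_mul_pderiv
  rw [map_sum, map_nsmul, nsmul_eq_mul] at h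
  push_cast at h
  have : 6 * eval v f = 2 * (3 * eval v f) := by ring
  rw [this, ← h, tri, Finset.mul_sum]
  apply Finset.sum_congr rfl
  intro i _
  rw [map_mul, eval_X, mul_left_comm, eval_pderiv1 f hf, Finset.mul_sum]
  apply Finset.sum_congr rfl
  intro j _
  rw [Finset.mul_sum]
  apply Finset.sum_congr rfl
  intro k _
  ring

lemma triCoeff_swap12 (f : MvPolynomial (Fin 3) ℂ) (i j k : Fin 3) :
    triCoeff f i j k = triCoeff f j i k := by
  rw [triCoeff, triCoeff, my_pderiv_comm j i]

lemma triCoeff_swap23 (f : MvPolynomial (Fin 3) ℂ) (i j k : Fin 3) :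
    triCoeff f i j k = triCoeff f i k j := by
  rw [triCoeff, triCoeff, my_pderiv_comm k j]

lemma tri_swap12 (f : MvPolynomial (Fin 3) ℂ) (u v w : Fin 3 → ℂ) :
    tri f u v w = tri f v u w := by
  rw [tri, tri, Finset.sum_comm]
  refine Finset.sum_congr rfl fun i _ => Finset.sum_congr rfl fun j _ =>
    Finset.sum_congr rfl fun k _ => ?_
  rw [triCoeff_swap12]; ring

lemma tri_swap23 (f : MvPolynomial (Fin 3) ℂ) (u v w : Fin 3 → ℂ) :
    tri f u v w = tri f u w v := by
  rw [tri, tri]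
  refine Finset.sum_congr rfl fun i _ => ?_
  rw [Finset.sum_comm]
  refine Finset.sum_congr rfl fun j _ => Finset.sum_congr rfl fun k _ => ?_
  rw [triCoeff_swap23]; ring

lemma tri_add (f : MvPolynomial (Fin 3) ℂ) (u v w w' : Fin 3 → ℂ) :
    tri f u v (w + w') = tri f u v w + tri f u v w' := by
  simp only [tri, Pi.add_apply, mul_add, Finset.sum_add_distrib]

lemma tri_smul (f : MvPolynomial (Fin 3) ℂ) (u v w : Fin 3 → ℂ) (c : ℂ) :
    tri f u v (c • w) = c * tri f u v w := by
  simp only [tri, Pi.smul_apply, smul_eq_mul, Finset.mul_sum]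
  refine Finset.sum_congr rfl fun i _ => Finset.sum_congr rfl fun j _ =>
    Finset.sum_congr rfl fun k _ => ?_
  ring

lemma tri_smooth (f : MvPolynomial (Fin 3) ℂ) (hf : f.IsHomogeneous 3)
    (hsmooth : ∀ v : Fin 3 → ℂ, v ≠ 0 → eval v f = 0 →
      ∃ i : Fin 3, eval v (pderiv i f) ≠ 0) (v : Fin 3 → ℂ) (hv : v ≠ 0) :
    ∃ w, tri f v v w ≠ 0 := by
  by_contra hcon
  push Not at hcon
  have h0 : eval v f = 0 := by
    have := eval_tri f hf v
    rw [hcon] at this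
    simpa using this
  obtain ⟨i, hi⟩ := hsmooth v hv h0
  apply hi
  have h1 := eval_pderiv1 f hf v i
  have h2 := hcon (Pi.single i 1)
  rw [tri_swap23, tri_swap12] at h2
  have h3 : tri f (Pi.single i 1) v v = ∑ j, ∑ k, triCoeff f i j k * v j * v k := by
    rw [tri, Finset.sum_eq_single i]
    · simp
    · intro b _ hb
      simp [hb]
    · simp
  rw [← h3, h2] at h1
  simpa using h1

noncomputable def hessPoly (f : MvPolynomial (Fin 3) ℂ) : MvPolynomial (Fin 3) ℂ :=
  (Matrix.of fun i j : Fin 3 => pderiv j (pderiv i f)).det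

lemma hess_null (f : MvPolynomial (Fin 3) ℂ) (hf : f.IsHomogeneous 3) (v : Fin 3 → ℂ)
    (h : eval v (hessPoly f) = 0) : ∃ u, u ≠ 0 ∧ ∀ w, tri f v u w = 0 := by
  rw [hessPoly, RingHom.map_det, ← Matrix.exists_mulVec_eq_zero_iff] at h
  obtain ⟨u, hu, h⟩ := h
  refine ⟨u, hu, fun w => ?_⟩
  rw [tri_swap12, tri_swap23, tri_swap12, tri]
  apply Finset.sum_eq_zero
  intro i _
  have hi := congrFun h i
  simp only [Matrix.mulVec, dotProduct, RingHom.mapMatrix_apply, Matrix.map_apply, Matrix.of_apply,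
    Pi.zero_apply, eval_pderiv2 f hf] at hi
  rw [← mul_zero (w i), ← hi, Finset.mul_sum]
  refine Finset.sum_congr rfl fun j _ => ?_
  rw [Finset.sum_mul, Finset.mul_sum]
  refine Finset.sum_congr rfl fun k _ => ?_
  ring

lemma hess_zero (f : MvPolynomial (Fin 3) ℂ) (hf : f.IsHomogeneous 3) :
    eval 0 (hessPoly f) = 0 := by
  rw [hessPoly, RingHom.map_det]
  have : (eval (0 : Fin 3 → ℂ)).mapMatrix (Matrix.of fun i j : Fin 3 => pderiv j (pderiv i f)) = 0 := by
    ext i j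
    rw [RingHom.mapMatrix_apply, Matrix.map_apply, Matrix.of_apply, eval_pderiv2 f hf]
    simp
  rw [this, Matrix.det_zero]


def Indep3 (p q r : Fin 3 → ℂ) : Prop :=
  ∀ x y z : ℂ, x • p + y • q + z • r = 0 → x = 0 ∧ y = 0 ∧ z = 0

def colMat (p q r : Fin 3 → ℂ) : Matrix (Fin 3) (Fin 3) ℂ :=
  Matrix.of fun i j => (![p, q, r] : Fin 3 → Fin 3 → ℂ) j i

lemma colMat_mulVec (p q r x : Fin 3 → ℂ) :
    colMat p q r *ᵥ x = x 0 • p + x 1 • q + x 2 • r := by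
  ext i
  simp [colMat, Matrix.mulVec, dotProduct, Fin.sum_univ_three, mul_comm]

lemma colMat_det (p q r : Fin 3 → ℂ) (h : Indep3 p q r) : (colMat p q r).det ≠ 0 := by
  intro hd
  rw [← Matrix.exists_mulVec_eq_zero_iff] at hd
  obtain ⟨x, hx, h0⟩ := hd
  rw [colMat_mulVec] at h0
  obtain ⟨h1, h2, h3⟩ := h _ _ _ h0
  apply hx
  ext i
  fin_cases i <;> assumption

lemma Indep3.span {p q r : Fin 3 → ℂ} (h : Indep3 p q r) (t : Fin 3 → ℂ) :
    ∃ x y z : ℂ, t = x • p + y • q + z • r := by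
  have hd := colMat_det p q r h
  refine ⟨_, _, _, (?_ : t = _).trans (colMat_mulVec p q r ((colMat p q r)⁻¹ *ᵥ t))⟩
  rw [Matrix.mulVec_mulVec, Matrix.mul_nonsing_inv _ (isUnit_iff_ne_zero.mpr hd), Matrix.one_mulVec]

structure IsTri (T : (Fin 3 → ℂ) → (Fin 3 → ℂ) → (Fin 3 → ℂ) → ℂ) : Prop where
  sw12 : ∀ u v w, T u v w = T v u w
  sw23 : ∀ u v w, T u v w = T u w v
  add3 : ∀ u v w w', T u v (w + w') = T u v w + T u v w'
  smul3 : ∀ u v w (c : ℂ), T u v (c • w) = c * T u v w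

namespace IsTri
variable {T : (Fin 3 → ℂ) → (Fin 3 → ℂ) → (Fin 3 → ℂ) → ℂ}

lemma add2 (h : IsTri T) (u v v' w : Fin 3 → ℂ) : T u (v + v') w = T u v w + T u v' w := by
  rw [h.sw23, h.add3, h.sw23 u w v, h.sw23 u w v']

lemma add1 (h : IsTri T) (u u' v w : Fin 3 → ℂ) : T (u + u') v w = T u v w + T u' v w := by
  rw [h.sw12, h.add2, h.sw12 v u, h.sw12 v u']

lemma smul2 (h : IsTri T) (u v w : Fin 3 → ℂ) (c : ℂ) : T u (c • v) w = c * T u v w := by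
  rw [h.sw23, h.smul3, h.sw23 u w v]

lemma smul1 (h : IsTri T) (u v w : Fin 3 → ℂ) (c : ℂ) : T (c • u) v w = c * T u v w := by
  rw [h.sw12, h.smul2, h.sw12 v u]

lemma zero3 (h : IsTri T) (u v : Fin 3 → ℂ) : T u v 0 = 0 := by
  have := h.smul3 u v 0 0
  simpa using this

/-- Full expansion in a basis. -/
lemma expand (h : IsTri T) (v u w : Fin 3 → ℂ) (x1 y1 z1 x2 y2 z2 x3 y3 z3 : ℂ) :
    T (x1 • v + y1 • u + z1 • w) (x2 • v + y2 • u + z2 • w) (x3 • v + y3 • u + z3 • w) =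
      x1 * x2 * x3 * T v v v + y1 * y2 * y3 * T u u u + z1 * z2 * z3 * T w w w
      + (x1 * x2 * y3 + x1 * y2 * x3 + y1 * x2 * x3) * T v v u
      + (x1 * x2 * z3 + x1 * z2 * x3 + z1 * x2 * x3) * T v v w
      + (y1 * y2 * x3 + y1 * x2 * y3 + x1 * y2 * y3) * T u u v
      + (y1 * y2 * z3 + y1 * z2 * y3 + z1 * y2 * y3) * T u u w
      + (z1 * z2 * x3 + z1 * x2 * z3 + x1 * z2 * z3) * T w w v
      + (z1 * z2 * y3 + z1 * y2 * z3 + y1 * z2 * z3) * T w w u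
      + (x1 * y2 * z3 + x1 * z2 * y3 + y1 * x2 * z3 + y1 * z2 * x3 + z1 * x2 * y3 + z1 * y2 * x3)
        * T v u w := by
  simp only [h.add1, h.add2, h.add3, h.smul1, h.smul2, h.smul3]
  have e1 : T v u v = T v v u := h.sw23 _ _ _
  have e2 : T u v v = T v v u := by rw [h.sw12, e1]
  have e3 : T v w v = T v v w := h.sw23 _ _ _
  have e4 : T w v v = T v v w := by rw [h.sw12, e3]
  have e5 : T u v u = T u u v := h.sw23 _ _ _
  have e6 : T v u u = T u u v := by rw [h.sw12, e5]
  have e7 : T u w u = T u u w := h.sw23 _ _ _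
  have e8 : T w u u = T u u w := by rw [h.sw12, e7]
  have e9 : T w v w = T w w v := h.sw23 _ _ _
  have e10 : T v w w = T w w v := by rw [h.sw12, e9]
  have e11 : T w u w = T w w u := h.sw23 _ _ _
  have e12 : T u w w = T w w u := by rw [h.sw12, e11]
  have e13 : T v w u = T v u w := h.sw23 _ _ _
  have e14 : T u v w = T v u w := h.sw12 _ _ _
  have e15 : T u w v = T v u w := by rw [h.sw23, e14]
  have e16 : T w v u = T v u w := by rw [h.sw12, e13]
  have e17 : T w u v = T v u w := by rw [h.sw12, e15]
  rw [e1, e2, e3, e4, e5, e6, e7, e8, e9, e10, e11, e12, e13, e14, e15, e16, e17]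
  ring

lemma indep (h : IsTri T) (v u w : Fin 3 → ℂ) (hu : u ≠ 0) (hvv : T v v v = 0)
    (hvu : ∀ w, T v u w = 0) (hw : T v v w ≠ 0) : Indep3 v u w := by
  intro x y z h0
  have hvvu : T v v u = 0 := by rw [h.sw23, hvu]
  have h1 := h.zero3 v v
  rw [← h0, h.add3, h.add3, h.smul3, h.smul3, h.smul3, hvv, hvvu] at h1
  have hz : z = 0 := by simpa [hw] using h1
  subst hz
  have h2 := h.zero3 v w
  rw [← h0, h.add3, h.add3, h.smul3, h.smul3, h.smul3, h.sw23 v w v, h.sw23 v w u, hvu] at h2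
  have hx : x = 0 := by simpa [hw] using h2
  subst hx
  refine ⟨rfl, ?_, rfl⟩
  simpa [hu] using h0

lemma cubic_ne (h : IsTri T) (hs : ∀ v, v ≠ 0 → ∃ w, T v v w ≠ 0)
    (v u w : Fin 3 → ℂ) (hu : u ≠ 0) (hvv : T v v v = 0)
    (hvu : ∀ w, T v u w = 0) (hw : T v v w ≠ 0) : T u u u ≠ 0 := by
  intro hα
  have hind := h.indep v u w hu hvv hvu hw
  obtain ⟨x, hx⟩ := IsAlgClosed.exists_pow_nat_eq (-(T u u w) / T v v w) (n := 2) (by norm_num)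
  have hx' : x ^ 2 * T v v w = - T u u w := by rw [hx]; field_simp
  have hp : x • v + (1 : ℂ) • u + (0 : ℂ) • w ≠ 0 := by
    intro h0
    exact one_ne_zero (hind _ _ _ h0).2.1
  obtain ⟨t, ht⟩ := hs _ hp
  obtain ⟨a, b, c, rfl⟩ := hind.span t
  apply ht
  have hvvu : T v v u = 0 := by rw [h.sw23, hvu]
  have huuv : T u u v = 0 := by rw [h.sw23, h.sw12, hvu]
  rw [h.expand, hvv, hα, hvvu, huuv, hvu]
  linear_combination c * hx'

lemma normal_form (h : IsTri T) (hs : ∀ v, v ≠ 0 → ∃ w, T v v w ≠ 0)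
    (v u : Fin 3 → ℂ) (hv : v ≠ 0) (hu : u ≠ 0) (hvv : T v v v = 0)
    (hvu : ∀ w, T v u w = 0) :
    ∃ w, T v v w ≠ 0 ∧ T u u u ≠ 0 ∧ T w w v = 0 ∧ T u u w = 0 := by
  obtain ⟨w, hw⟩ := hs v hv
  have hα := h.cubic_ne hs v u w hu hvv hvu hw
  have hvvu : T v v u = 0 := by rw [h.sw23, hvu]
  have huuv : T u u v = 0 := by rw [h.sw23, h.sw12, hvu]
  have E := h.expand v u w
  simp only [hvv, hvvu, huuv, hvu] at E
  refine ⟨(-(T w w v) / (2 * T v v w)) • v + (-(T u u w) / T u u u) • u + (1 : ℂ) • w, ?_, hα, ?_, ?_⟩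
  · rw [h.add3, h.add3, h.smul3, h.smul3, h.smul3, hvv, hvvu]
    simpa using hw
  · have := E (-(T w w v) / (2 * T v v w)) (-(T u u w) / T u u u) 1
      (-(T w w v) / (2 * T v v w)) (-(T u u w) / T u u u) 1 1 0 0
    simp only [one_smul, zero_smul, add_zero] at this ⊢
    rw [this]
    field_simp
    ring
  · rw [h.add3, h.add3, h.smul3, h.smul3, h.smul3, huuv]
    field_simp
    ring

lemma exists_quartic_root (α B C D : ℂ) (hα : α ≠ 0) :
    ∃ c : ℂ, α * c ^ 4 + B * c ^ 2 + C * c + D = 0 := by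
  let P : Polynomial ℂ := Polynomial.C α * Polynomial.X ^ 4 + (Polynomial.C B * Polynomial.X ^ 2
    + Polynomial.C C * Polynomial.X + Polynomial.C D)
  have hdeg : P.degree = 4 := by
    simp only [P]
    compute_degree!
  obtain ⟨c, hc⟩ := IsAlgClosed.exists_root P (by rw [hdeg]; norm_num)
  refine ⟨c, ?_⟩
  simp [P, Polynomial.IsRoot] at hc
  linear_combination hc

lemma triangle (h : IsTri T) (hs : ∀ v, v ≠ 0 → ∃ w, T v v w ≠ 0)
    (v u : Fin 3 → ℂ) (hv : v ≠ 0) (hu : u ≠ 0) (hvv : T v v v = 0)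
    (hvu : ∀ w, T v u w = 0) :
    ∃ p q r, Indep3 p q r ∧ T p p q = 0 ∧ T p p r = 0 ∧ T q q p = 0 ∧ T q q r = 0 ∧
      T r r p = 0 ∧ T r r q = 0 := by
  obtain ⟨w, hw, hα, hwwv, huuw⟩ := h.normal_form hs v u hv hu hvv hvu
  have hind := h.indep v u w hu hvv hvu hw
  have hvvu : T v v u = 0 := by rw [h.sw23, hvu]
  have huuv : T u u v = 0 := by rw [h.sw23, h.sw12, hvu]
  have E := h.expand v u w
  simp only [hvv, hvvu, huuv, hvu, hwwv, huuw] at E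
  generalize T v v w = β at *
  generalize T u u u = α at *
  generalize T w w u = ε at *
  generalize T w w w = ζ at *
  obtain ⟨c, hc⟩ := exists_quartic_root (α ^ 2) (6 * α * ε) (4 * α * ζ) (-3 * ε ^ 2)
    (pow_ne_zero 2 hα)
  obtain ⟨s, hs2⟩ := IsAlgClosed.exists_pow_nat_eq ((α * c ^ 3 + 3 * ε * c + ζ) / β) (n := 2)
    (by norm_num)
  have hs' : β * s ^ 2 = α * c ^ 3 + 3 * ε * c + ζ := by rw [hs2]; field_simp
  have hs0 : s ≠ 0 := by
    rintro rfl
    have hζ : ζ = -(α * c ^ 3 + 3 * ε * c) := by linear_combination -hs'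
    have h1 : α * c ^ 2 + ε = 0 := by
      have : (α * c ^ 2 + ε) ^ 2 = 0 := by
        rw [hζ] at hc
        linear_combination (-1 / 3) * hc
      exact pow_eq_zero_iff (two_ne_zero) |>.mp this
    have hp : (0 : ℂ) • v + c • u + (1 : ℂ) • w ≠ 0 := by
      intro h0
      exact one_ne_zero (hind _ _ _ h0).2.2
    obtain ⟨t, ht⟩ := hs _ hp
    obtain ⟨x, y, z, rfl⟩ := hind.span t
    apply ht
    rw [E, hζ]
    linear_combination (y - z * c) * h1
  have hne : α * c ^ 3 + 3 * ε * c + ζ ≠ 0 := by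
    rw [← hs']
    exact mul_ne_zero hw (pow_ne_zero 2 hs0)
  refine ⟨(0 : ℂ) • v + (-(α * c ^ 3 + 5 * ε * c + 2 * ζ)) • u + (α * c ^ 2 + ε) • w,
    s • v + c • u + (1 : ℂ) • w, (-s) • v + c • u + (1 : ℂ) • w, ?_, ?_, ?_, ?_, ?_, ?_, ?_⟩
  · intro x y z h0
    obtain ⟨h1, h2, h3⟩ := hind (s * y - s * z)
      (-(α * c ^ 3 + 5 * ε * c + 2 * ζ) * x + c * (y + z)) ((α * c ^ 2 + ε) * x + (y + z)) (by
        rw [← h0]; module)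
    have hx : x = 0 := by
      have : x * (α * c ^ 3 + 3 * ε * c + ζ) = 0 := by linear_combination (c * h3 - h2) / 2
      simpa [hne] using this
    subst hx
    have hyz : y = z := by
      have : s * (y - z) = 0 := by linear_combination h1
      have := (mul_eq_zero.mp this).resolve_left hs0
      linear_combination this
    subst hyz
    have : y = 0 := by linear_combination h3 / 2
    exact ⟨rfl, this, this⟩
  · rw [E]
    linear_combination (α * c ^ 3 + 3 * ε * c + ζ) * hc
  · rw [E]
    linear_combination (α * c ^ 3 + 3 * ε * c + ζ) * hc
  · rw [E]
    linear_combination (α * c ^ 2 + ε) * hs'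
  · rw [E]
    linear_combination -hs'
  · rw [E]
    linear_combination (α * c ^ 2 + ε) * hs'
  · rw [E]
    linear_combination -hs'

lemma diag_ne (h : IsTri T) (hs : ∀ v, v ≠ 0 → ∃ w, T v v w ≠ 0) (p q r : Fin 3 → ℂ)
    (hp : p ≠ 0) (hsp : ∀ t, ∃ x y z : ℂ, t = x • p + y • q + z • r)
    (h1 : T p p q = 0) (h2 : T p p r = 0) : T p p p ≠ 0 := by
  intro h0
  obtain ⟨t, ht⟩ := hs p hp
  obtain ⟨x, y, z, rfl⟩ := hsp t
  apply ht
  rw [h.add3, h.add3, h.smul3, h.smul3, h.smul3, h0, h1, h2]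
  ring

lemma rescale (h : IsTri T) (p : Fin 3 → ℂ) (hp : T p p p ≠ 0) :
    ∃ m : ℂ, m ≠ 0 ∧ T (m • p) (m • p) (m • p) = 1 := by
  obtain ⟨m, hm⟩ := IsAlgClosed.exists_pow_nat_eq ((T p p p)⁻¹) (n := 3) (by norm_num)
  refine ⟨m, ?_, ?_⟩
  · rintro rfl
    simp at hm
    exact hp hm.symm
  · rw [h.smul1, h.smul2, h.smul3]
    have : m ^ 3 * T p p p = 1 := by rw [hm]; field_simp
    linear_combination this

lemma hesse (h : IsTri T) (hs : ∀ v, v ≠ 0 → ∃ w, T v v w ≠ 0)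
    (v u : Fin 3 → ℂ) (hv : v ≠ 0) (hu : u ≠ 0) (hvv : T v v v = 0)
    (hvu : ∀ w, T v u w = 0) :
    ∃ (E : Matrix (Fin 3) (Fin 3) ℂ) (l : ℂ), E.det ≠ 0 ∧ ∀ x : Fin 3 → ℂ,
      T (E *ᵥ x) (E *ᵥ x) (E *ᵥ x) = x 0 ^ 3 + x 1 ^ 3 + x 2 ^ 3 + l * (x 0 * x 1 * x 2) := by
  obtain ⟨p, q, r, hind, hpq, hpr, hqp, hqr, hrp, hrq⟩ := h.triangle hs v u hv hu hvv hvu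
  have hp : p ≠ 0 := by
    rintro rfl
    simpa using (hind 1 0 0 (by simp)).1
  have hq : q ≠ 0 := by
    rintro rfl
    simpa using (hind 0 1 0 (by simp)).2.1
  have hr : r ≠ 0 := by
    rintro rfl
    simpa using (hind 0 0 1 (by simp)).2.2
  have hppp := h.diag_ne hs p q r hp hind.span hpq hpr
  have hqqq := h.diag_ne hs q p r hq (fun t => by
    obtain ⟨x, y, z, rfl⟩ := hind.span t
    exact ⟨y, x, z, by module⟩) hqp hqr
  have hrrr := h.diag_ne hs r p q hr (fun t => by
    obtain ⟨x, y, z, rfl⟩ := hind.span t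
    exact ⟨z, x, y, by module⟩) hrp hrq
  obtain ⟨a, ha, ha'⟩ := h.rescale p hppp
  obtain ⟨b, hb, hb'⟩ := h.rescale q hqqq
  obtain ⟨c, hc, hc'⟩ := h.rescale r hrrr
  refine ⟨colMat (a • p) (b • q) (c • r), 6 * T (a • p) (b • q) (c • r), ?_, fun x => ?_⟩
  · apply colMat_det
    intro x y z h0
    have := hind (x * a) (y * b) (z * c) (by rw [← h0]; module)
    simpa [ha, hb, hc] using this
  · rw [colMat_mulVec, h.expand, ha', hb', hc']
    simp only [h.smul1, h.smul2, h.smul3, hpq, hpr, hqp, hqr, hrp, hrq]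
    ring

end IsTri

/-- Every smooth cubic curve `C ⊆ P²` over `ℂ` (the zero set of an
irreducible cubic form `f` whose gradient does not vanish at any nonzero zero of `f`)
is mapped onto a Hesse cubic `x₁³ + x₂³ + x₃³ + λx₁x₂x₃ = 0` by a projective linear
transformation `g ∈ PGL₃(ℂ)`.  Here `g` is represented by a matrix `M ∈ GL₃(ℂ)` (the
projective transformations are exactly the classes of invertible matrices), and
`g(C)` is the Hesse cubic iff for every nonzero `v ∈ ℂ³`, `v` lies on the Hesse cubic
exactly when `g⁻¹v = M⁻¹v` lies on `C`. -/
theorem stmt9 (f : MvPolynomial (Fin 3) ℂ)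
    (hdeg : f.IsHomogeneous 3)
    (hirr : Irreducible f)
    (hsmooth : ∀ v : Fin 3 → ℂ, v ≠ 0 → eval v f = 0 →
      ∃ i : Fin 3, eval v (pderiv i f) ≠ 0) :
    ∃ (M : GL (Fin 3) ℂ) (l : ℂ), ∀ v : Fin 3 → ℂ, v ≠ 0 →
      (eval v (hesseCubic l) = 0 ↔ eval ((↑M⁻¹ : Matrix (Fin 3) (Fin 3) ℂ) *ᵥ v) f = 0) := by
  obtain ⟨v, hv, hfv, hHv⟩ := exists_common_zero f (hessPoly f)
    (by have := eval_tri f hdeg 0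
        simpa [tri] using this) (hess_zero f hdeg)
  obtain ⟨u, hu, hvu⟩ := hess_null f hdeg v hHv
  have hT : IsTri (tri f) := ⟨tri_swap12 f, tri_swap23 f, tri_add f, tri_smul f⟩
  obtain ⟨E, l, hE, hEl⟩ := hT.hesse (tri_smooth f hdeg hsmooth) v u hv hu
    (by rw [← eval_tri f hdeg, hfv, mul_zero]) hvu
  refine ⟨(Matrix.GeneralLinearGroup.mkOfDetNeZero E hE)⁻¹, l, fun x _ => ?_⟩
  rw [inv_inv]
  have h1 : ((Matrix.GeneralLinearGroup.mkOfDetNeZero E hE : GL (Fin 3) ℂ) :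
    Matrix (Fin 3) (Fin 3) ℂ) = E := rfl
  have h2 : eval x (hesseCubic l) = 6 * eval (E *ᵥ x) f := by
    rw [eval_tri f hdeg, hEl]
    simp [hesseCubic]
  rw [h1, h2]
  simp
end
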